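/- For every integer k ≥ 0 there exist constants a_k, d_k > 0 such that for every n ≥ 2 there is a total Boolean function f : {0,1}^{N} → {0,1} with N ≤ a_k · n^(25^k), R(f) ≥ n^(2k+1) / (a_k · (log₂ n)^{d_k}), and UC(f) ≤ a_k · n^(k+1) · (log₂ n)^{d_k}. -/

import Mathlib

/-! ### Partial assignments and certificate complexity -/

/-- An input `x` is consistent with a partial assignment `p` if it agrees with
`p` wherever `p` is defined. -/
def Consistent {n : ℕ} (x : Fin n → Bool) (p : Fin n → Option Bool) : Prop :=
  ∀ i : Fin n, ∀ b : Bool, p i = some b → x i = b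

instance {n : ℕ} (x : Fin n → Bool) (p : Fin n → Option Bool) :
    Decidable (Consistent x p) := by unfold Consistent; infer_instance

/-- The width of a partial assignment: the number of fixed coordinates. -/
def paWidth {n : ℕ} (p : Fin n → Option Bool) : ℕ :=
  (Finset.univ.filter (fun i : Fin n => (p i).isSome)).card

/-- `p` is a `b`-certificate for `f`: every input consistent with `p` has value `b`. -/
def IsCert {n : ℕ} (f : (Fin n → Bool) → Bool) (b : Bool) (p : Fin n → Option Bool) : Prop :=
  ∀ x : Fin n → Bool, Consistent x p → f x = b

instance {n : ℕ} (f : (Fin n → Bool) → Bool) (b : Bool) (p : Fin n → Option Bool) :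
    Decidable (IsCert f b p) := by unfold IsCert; infer_instance

/-- The `b`-certificate complexity `C_b(f)`. -/
noncomputable def certC {n : ℕ} (f : (Fin n → Bool) → Bool) (b : Bool) : ℕ :=
  sInf {w : ℕ | ∀ x : Fin n → Bool, f x = b →
    ∃ p : Fin n → Option Bool, IsCert f b p ∧ paWidth p ≤ w ∧ Consistent x p}

/-- The certificate complexity `C(f) = max{C_0(f), C_1(f)}`. -/
noncomputable def certCC {n : ℕ} (f : (Fin n → Bool) → Bool) : ℕ :=
  max (certC f false) (certC f true)

/-- The unambiguous `b`-certificate complexity `UC_b(f)`. -/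
noncomputable def UCb {n : ℕ} (f : (Fin n → Bool) → Bool) (b : Bool) : ℕ :=
  sInf {w : ℕ | ∃ S : Set (Fin n → Option Bool),
    (∀ p ∈ S, IsCert f b p ∧ paWidth p ≤ w) ∧
    ∀ x : Fin n → Bool, f x = b → ∃! p, p ∈ S ∧ Consistent x p}

/-- Subcube partition complexity `UC(f) = max{UC_0(f), UC_1(f)}`. -/
noncomputable def UC {n : ℕ} (f : (Fin n → Bool) → Bool) : ℕ :=
  max (UCb f false) (UCb f true)

/-! ### Decision trees, deterministic and randomized query complexity -/

/-- Deterministic decision trees on `n` bits. -/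
inductive DT (n : ℕ) where
  | leaf : Bool → DT n
  | node : Fin n → DT n → DT n → DT n

/-- Evaluation of a decision tree on an input. -/
def DT.eval {n : ℕ} : DT n → (Fin n → Bool) → Bool
  | .leaf b, _ => b
  | .node i t0 t1, x => if x i then t1.eval x else t0.eval x

/-- Depth of a decision tree. -/
def DT.depth {n : ℕ} : DT n → ℕ
  | .leaf _ => 0
  | .node _ t0 t1 => 1 + max t0.depth t1.depth

/-- Deterministic query complexity `D(f)`. -/
noncomputable def Dquery {n : ℕ} (f : (Fin n → Bool) → Bool) : ℕ :=
  sInf {d : ℕ | ∃ T : DT n, T.depth ≤ d ∧ ∀ x, T.eval x = f x}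

/-- Bounded-error randomized query complexity `R(f)`: minimum over finitely
supported distributions over deterministic trees computing `f` with error `≤ 1/3`
of the maximum depth in the support. -/
noncomputable def Rquery {n : ℕ} (f : (Fin n → Bool) → Bool) : ℕ :=
  sInf {d : ℕ | ∃ ts : List (DT n × ℝ),
    (∀ p ∈ ts, 0 ≤ p.2 ∧ p.1.depth ≤ d) ∧
    (ts.map Prod.snd).sum = 1 ∧
    ∀ x : Fin n → Bool,
      (2 : ℝ) / 3 ≤ ((ts.filter (fun p => p.1.eval x == f x)).map Prod.snd).sum}

/-! ### Decision trees with real leaves -/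

/-- Decision trees over an arbitrary index type whose leaves carry real numbers. -/
inductive QTree (ι : Type) where
  | leaf : ℝ → QTree ι
  | node : ι → QTree ι → QTree ι → QTree ι

namespace QTree

variable {ι κ : Type}

/-- The value of the leaf reached on an input. -/
def out : QTree ι → (ι → Bool) → ℝ
  | leaf r, _ => r
  | node i s t, x => if x i then t.out x else s.out x

/-- The total weight of the queries made on an input, when querying `i` has weight `w i`. -/
def cost (w : ι → ℝ) : QTree ι → (ι → Bool) → ℝ
  | leaf _, _ => 0
  | node i s t, x => w i + if x i then t.cost w x else s.cost w x

/-- All leaves lie in the unit interval. -/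
def Bdd : QTree ι → Prop
  | leaf r => 0 ≤ r ∧ r ≤ 1
  | node _ s t => s.Bdd ∧ t.Bdd

/-- The depth of a tree. -/
def depth : QTree ι → ℕ
  | leaf _ => 0
  | node _ s t => max s.depth t.depth + 1

lemma Bdd.out_mem {T : QTree ι} (hT : T.Bdd) (x : ι → Bool) : 0 ≤ T.out x ∧ T.out x ≤ 1 := by
  induction T with
  | leaf r => exact hT
  | node i s t hs ht =>
    simp only [out]
    split_ifs
    exacts [ht hT.2, hs hT.1]

lemma cost_mono {w w' : ι → ℝ} (h : w ≤ w') (T : QTree ι) (x : ι → Bool) :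
    T.cost w x ≤ T.cost w' x := by
  induction T with
  | leaf r => exact le_rfl
  | node i s t hs ht =>
    simp only [cost]
    have := h i
    split_ifs <;> linarith

lemma cost_zero (T : QTree ι) (x : ι → Bool) : T.cost 0 x = 0 := by
  induction T with
  | leaf r => rfl
  | node i s t hs ht => simp [cost, hs, ht]

lemma cost_nonneg {w : ι → ℝ} (h : 0 ≤ w) (T : QTree ι) (x : ι → Bool) : 0 ≤ T.cost w x :=
  (T.cost_zero x).symm.le.trans (cost_mono h T x)

lemma cost_le_depth (T : QTree ι) (x : ι → Bool) : T.cost 1 x ≤ T.depth := by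
  induction T with
  | leaf r => simp [cost, depth]
  | node i s t hs ht =>
    simp only [cost, depth, Pi.one_apply]
    push_cast
    have h1 := le_max_left (s.depth : ℝ) t.depth
    have h2 := le_max_right (s.depth : ℝ) t.depth
    split_ifs <;> linarith

lemma sum_cost {α : Type} [Fintype α] (w : α → ι → ℝ) (T : QTree ι) (x : ι → Bool) :
    ∑ a, T.cost (w a) x = T.cost (fun i => ∑ a, w a i) x := by
  induction T with
  | leaf r => simp [cost]
  | node i s t hs ht =>
    simp only [cost, Finset.sum_add_distrib]
    split_ifs
    exacts [by rw [ht], by rw [hs]]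

/-- Replace every leaf value `r` by `1 - r`. -/
def compl : QTree ι → QTree ι
  | leaf r => leaf (1 - r)
  | node i s t => node i s.compl t.compl

lemma out_compl (T : QTree ι) (x : ι → Bool) : T.compl.out x = 1 - T.out x := by
  induction T with
  | leaf r => rfl
  | node i s t hs ht => simp only [compl, out, hs, ht]; split_ifs <;> rfl

lemma cost_compl (w : ι → ℝ) (T : QTree ι) (x : ι → Bool) : T.compl.cost w x = T.cost w x := by
  induction T with
  | leaf r => rfl
  | node i s t hs ht => simp only [compl, cost, hs, ht]

lemma Bdd.compl {T : QTree ι} (hT : T.Bdd) : T.compl.Bdd := by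
  induction T with
  | leaf r => exact ⟨by linarith [hT.2], by linarith [hT.1]⟩
  | node i s t hs ht => exact ⟨hs hT.1, ht hT.2⟩

/-- Cut a tree off at depth `D`; the new leaves have value `0`. -/
def trunc : ℕ → QTree ι → QTree ι
  | _, leaf r => leaf r
  | 0, node _ _ _ => leaf 0
  | D + 1, node i s t => node i (trunc D s) (trunc D t)

lemma depth_trunc (D : ℕ) (T : QTree ι) : (T.trunc D).depth ≤ D := by
  induction T generalizing D with
  | leaf r => simp [trunc, depth]
  | node i s t hs ht =>
    cases D with
    | zero => simp [trunc, depth]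
    | succ D => simpa [trunc, depth] using ⟨hs D, ht D⟩

lemma Bdd.trunc {T : QTree ι} (hT : T.Bdd) (D : ℕ) : (T.trunc D).Bdd := by
  induction T generalizing D with
  | leaf r => simpa [QTree.trunc] using hT
  | node i s t hs ht =>
    cases D with
    | zero => simp [QTree.trunc, Bdd]
    | succ D => exact ⟨hs hT.1 D, ht hT.2 D⟩

lemma Bdd.out_trunc_le {T : QTree ι} (hT : T.Bdd) (D : ℕ) (x : ι → Bool) :
    (T.trunc D).out x ≤ T.out x := by
  induction T generalizing D with
  | leaf r => simp [QTree.trunc]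
  | node i s t hs ht =>
    cases D with
    | zero => simpa [QTree.trunc, out] using (hT.out_mem x).1
    | succ D =>
      simp only [QTree.trunc, out]
      split_ifs
      exacts [ht hT.2 D, hs hT.1 D]

lemma cost_trunc_le (D : ℕ) (T : QTree ι) (x : ι → Bool) :
    (T.trunc D).cost 1 x ≤ T.cost 1 x := by
  induction T generalizing D with
  | leaf r => simp [trunc]
  | node i s t hs ht =>
    cases D with
    | zero =>
      simpa [trunc, cost] using cost_nonneg (w := 1) (fun _ => zero_le_one) (node i s t) x
    | succ D =>
      simp only [trunc, cost]
      split_ifs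
      exacts [by linarith [ht D], by linarith [hs D]]

lemma out_trunc_eq_or (D : ℕ) (T : QTree ι) (x : ι → Bool) :
    (T.trunc D).out x = T.out x ∨ (T.trunc D).cost 1 x = D := by
  induction T generalizing D with
  | leaf r => simp [trunc]
  | node i s t hs ht =>
    cases D with
    | zero => simp [trunc, cost]
    | succ D =>
      simp only [trunc, cost, out, Pi.one_apply]
      push_cast
      split_ifs
      · exact (ht D).imp id fun h => by rw [h]; ring
      · exact (hs D).imp id fun h => by rw [h]; ring

/-- Relabel each leaf by `(m + its depth) / D`. -/
noncomputable def costTree (D : ℝ) : ℝ → QTree ι → QTree ι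
  | m, leaf _ => leaf (m / D)
  | m, node i s t => node i (costTree D (m + 1) s) (costTree D (m + 1) t)

lemma out_costTree (D m : ℝ) (T : QTree ι) (x : ι → Bool) :
    (T.costTree D m).out x = (m + T.cost 1 x) / D := by
  induction T generalizing m with
  | leaf r => simp [costTree, out, cost]
  | node i s t hs ht =>
    simp only [costTree, out, cost, hs, ht, Pi.one_apply]
    split_ifs <;> ring

lemma cost_costTree (w : ι → ℝ) (D m : ℝ) (T : QTree ι) (x : ι → Bool) :
    (T.costTree D m).cost w x = T.cost w x := by
  induction T generalizing m with
  | leaf r => rfl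
  | node i s t hs ht => simp only [costTree, cost, hs, ht]

lemma bdd_costTree {D m : ℝ} (hD : 0 < D) (hm : 0 ≤ m) {T : QTree ι} (h : m + T.depth ≤ D) :
    (T.costTree D m).Bdd := by
  induction T generalizing m with
  | leaf r =>
    simp only [depth, Nat.cast_zero, add_zero] at h
    exact ⟨by positivity, by rwa [div_le_one hD]⟩
  | node i s t hs ht =>
    simp only [depth] at h
    push_cast at h
    have h1 := le_max_left (s.depth : ℝ) t.depth
    have h2 := le_max_right (s.depth : ℝ) t.depth
    exact ⟨hs (by linarith) (by linarith), ht (by linarith) (by linarith)⟩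

/-- Rename some indices and fix the values of the others. -/
def subst (r : ι → κ ⊕ Bool) : QTree ι → QTree κ
  | leaf v => leaf v
  | node i s t =>
    match r i with
    | .inl k => node k (s.subst r) (t.subst r)
    | .inr b => if b then t.subst r else s.subst r

lemma out_subst (r : ι → κ ⊕ Bool) (T : QTree ι) (x : κ → Bool) :
    (T.subst r).out x = T.out (fun i => Sum.elim x id (r i)) := by
  induction T with
  | leaf v => rfl
  | node i s t hs ht =>
    cases h : r i with
    | inl k => simp [subst, h, out, hs, ht]
    | inr b => cases b <;> simp [subst, h, out, hs, ht]

lemma cost_subst (r : ι → κ ⊕ Bool) (w : κ → ℝ) (T : QTree ι) (x : κ → Bool) :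
    (T.subst r).cost w x =
      T.cost (fun i => Sum.elim w 0 (r i)) (fun i => Sum.elim x id (r i)) := by
  induction T with
  | leaf v => rfl
  | node i s t hs ht =>
    cases h : r i with
    | inl k => simp [subst, h, cost, hs, ht]
    | inr b => cases b <;> simp [subst, h, cost, hs, ht]

lemma Bdd.subst {T : QTree ι} (hT : T.Bdd) (r : ι → κ ⊕ Bool) : (T.subst r).Bdd := by
  induction T with
  | leaf v => exact hT
  | node i s t hs ht =>
    simp only [QTree.subst]
    cases h : r i with
    | inl k => exact ⟨hs hT.1, ht hT.2⟩
    | inr b =>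
      cases b
      · simpa using hs hT.1
      · simpa using ht hT.2

open Classical in
/-- The tree which outputs `1` as soon as an index in `A` is about to be queried,
and `0` if this never happens. -/
noncomputable def hit (A : Set ι) : QTree ι → QTree ι
  | leaf _ => leaf 0
  | node i s t => if i ∈ A then leaf 1 else node i (s.hit A) (t.hit A)

lemma bdd_hit (A : Set ι) (T : QTree ι) : (T.hit A).Bdd := by
  induction T with
  | leaf v => simp [hit, Bdd]
  | node i s t hs ht =>
    simp only [hit]
    split_ifs
    · simp [Bdd]
    · exact ⟨hs, ht⟩

lemma cost_hit_le (A : Set ι) {w : ι → ℝ} (hw : 0 ≤ w) (T : QTree ι) (x : ι → Bool) :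
    (T.hit A).cost w x ≤ T.cost w x := by
  induction T with
  | leaf v => exact le_rfl
  | node i s t hs ht =>
    have h := cost_nonneg hw (node i s t) x
    simp only [hit]
    split_ifs
    · exact h
    · simp only [cost]
      split_ifs <;> linarith

lemma out_hit_le (A : Set ι) (T : QTree ι) (x : ι → Bool) :
    (T.hit A).out x ≤ T.cost (A.indicator 1) x := by
  have h0 : (0 : ι → ℝ) ≤ A.indicator 1 := Set.indicator_nonneg fun _ _ => zero_le_one
  induction T with
  | leaf v => exact le_rfl
  | node i s t hs ht =>
    have h1 := cost_nonneg h0 s x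
    have h2 := cost_nonneg h0 t x
    simp only [hit, cost]
    split_ifs with hi hx hx <;> simp only [out, hi, hx, Set.indicator, if_true, if_false,
      Pi.one_apply] <;> simp <;> linarith

lemma Bdd.out_sub_out_le {T : QTree ι} (hT : T.Bdd) {A : Set ι} {x y : ι → Bool}
    (h : ∀ i ∉ A, x i = y i) : T.out x - T.out y ≤ (T.hit A).out x := by
  induction T with
  | leaf v => simp [out, hit]
  | node i s t hs ht =>
    have h1 := hT.out_mem x
    have h2 := hT.out_mem y
    simp only [hit]
    split_ifs with hi
    · simp only [out] at *
      linarith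
    · simp only [out, ← h i hi]
      split_ifs
      exacts [ht hT.2, hs hT.1]

end QTree

/-! ### Hard pairs of distributions -/

/-- `X` and `Y` describe two distributions on inputs (push-forwards of the uniform distribution
on `Ω`). The pair is `ε`-hard if no tree tells `X` from `Y` with an advantage larger than `ε`
times its expected number of queries under `X`. -/
def Hard {Ω ι : Type} [Fintype Ω] (X Y : Ω → ι → Bool) (ε : ℝ) : Prop :=
  ∀ T : QTree ι, T.Bdd →
    ∑ ω, T.out (X ω) - ∑ ω, T.out (Y ω) ≤ ε * ∑ ω, T.cost 1 (X ω)

namespace Hard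

variable {Ω ι : Type} [Fintype Ω] {X Y : Ω → ι → Bool} {ε δ : ℝ}

lemma sum_cost_nonneg (X : Ω → ι → Bool) (T : QTree ι) : 0 ≤ ∑ ω, T.cost 1 (X ω) :=
  Finset.sum_nonneg fun _ _ => QTree.cost_nonneg (fun _ => zero_le_one) _ _

lemma mono (h : Hard X Y ε) (hε : ε ≤ δ) : Hard X Y δ := fun T hT =>
  (h T hT).trans (mul_le_mul_of_nonneg_right hε (sum_cost_nonneg X T))

lemma refl (X : Ω → ι → Bool) (hε : 0 ≤ ε) : Hard X X ε := fun T _ => by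
  rw [sub_self]
  exact mul_nonneg hε (sum_cost_nonneg X T)

lemma of_one_le (X Y : Ω → ι → Bool) (hε : 1 ≤ ε) : Hard X Y ε := by
  refine mono (ε := 1) (fun T hT => ?_) hε
  rw [one_mul, ← Finset.sum_sub_distrib]
  refine Finset.sum_le_sum fun ω _ => ?_
  cases T with
  | leaf r => simp [QTree.out, QTree.cost]
  | node i s t =>
    have h1 := (hT.out_mem (X ω)).2
    have h2 := (hT.out_mem (Y ω)).1
    have h3 := QTree.cost_nonneg (w := 1) (fun _ => zero_le_one) s (X ω)
    have h4 := QTree.cost_nonneg (w := 1) (fun _ => zero_le_one) t (X ω)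
    simp only [QTree.cost, Pi.one_apply]
    split_ifs <;> linarith

/-- The reverse difference is controlled by the same quantity. -/
lemma rev (h : Hard X Y ε) {T : QTree ι} (hT : T.Bdd) :
    ∑ ω, T.out (Y ω) - ∑ ω, T.out (X ω) ≤ ε * ∑ ω, T.cost 1 (X ω) := by
  have := h T.compl hT.compl
  simp only [QTree.out_compl, QTree.cost_compl, Finset.sum_sub_distrib] at this
  linarith

/-- It suffices to consider trees of bounded depth. -/
lemma of_depth_le {D : ℕ} (hD : 0 < D)
    (h : ∀ T : QTree ι, T.Bdd → T.depth ≤ D →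
      ∑ ω, T.out (X ω) - ∑ ω, T.out (Y ω) ≤ ε * ∑ ω, T.cost 1 (X ω)) (hε : 0 ≤ ε) :
    Hard X Y (ε + 1 / D) := by
  intro T hT
  have hD' : (0 : ℝ) < D := by exact_mod_cast hD
  have h1 := h (T.trunc D) (hT.trunc D) (T.depth_trunc D)
  have h2 : ∑ ω, (T.trunc D).out (Y ω) ≤ ∑ ω, T.out (Y ω) :=
    Finset.sum_le_sum fun ω _ => hT.out_trunc_le D _
  have h3 : ∑ ω, (T.trunc D).cost 1 (X ω) ≤ ∑ ω, T.cost 1 (X ω) :=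
    Finset.sum_le_sum fun ω _ => QTree.cost_trunc_le D T _
  have h4 : ∑ ω, T.out (X ω) ≤ ∑ ω, ((T.trunc D).out (X ω) + 1 / D * T.cost 1 (X ω)) := by
    refine Finset.sum_le_sum fun ω _ => ?_
    have h5 := QTree.cost_trunc_le D T (X ω)
    have h6 : 0 ≤ T.cost 1 (X ω) := QTree.cost_nonneg (fun _ => zero_le_one) _ _
    rcases T.out_trunc_eq_or D (X ω) with h | h
    · rw [h]
      have : 0 ≤ 1 / (D : ℝ) * T.cost 1 (X ω) := by positivity
      linarith
    · rw [h] at h5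
      have h7 : 1 ≤ 1 / (D : ℝ) * T.cost 1 (X ω) := by
        rw [one_div, inv_mul_eq_div, le_div_iff₀ hD']
        linarith
      have h8 := ((hT.trunc D).out_mem (X ω)).1
      have h9 := (hT.out_mem (X ω)).2
      linarith
  rw [Finset.sum_add_distrib, ← Finset.mul_sum] at h4
  have h5 := mul_le_mul_of_nonneg_left h3 hε
  rw [add_mul]
  linarith

/-- Expected costs of trees of depth at most `D` change little. -/
lemma sum_cost_le (h : Hard X Y ε) {D : ℕ} (hD : 0 < D) (hDε : ε * D ≤ 1 / 2) {T : QTree ι}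
    (hT : T.depth ≤ D) : ∑ ω, T.cost 1 (X ω) ≤ 2 * ∑ ω, T.cost 1 (Y ω) := by
  have hD' : (0 : ℝ) < D := by exact_mod_cast hD
  have h1 := h (T.costTree D 0)
    (QTree.bdd_costTree hD' le_rfl (by rw [zero_add]; exact_mod_cast hT))
  simp only [QTree.out_costTree, QTree.cost_costTree, zero_add, ← Finset.sum_div] at h1
  rw [← sub_div, div_le_iff₀ hD'] at h1
  nlinarith [sum_cost_nonneg X T]

lemma exists_depth (hδ : 0 < δ) (h : δ ≤ 1 / 2) :
    ∃ D : ℕ, 0 < D ∧ δ * D ≤ 1 / 2 ∧ 1 / (D : ℝ) ≤ 4 * δ := by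
  have h1 : 1 ≤ 1 / (2 * δ) := by rw [le_div_iff₀ (by positivity)]; linarith
  have h2 : 0 < ⌊1 / (2 * δ)⌋₊ := Nat.floor_pos.2 h1
  have h3 := Nat.floor_le (zero_le_one.trans h1)
  have h4 := Nat.lt_floor_add_one (1 / (2 * δ))
  have h5 : (1 : ℝ) ≤ ⌊1 / (2 * δ)⌋₊ := by exact_mod_cast h2
  refine ⟨_, h2, ?_, ?_⟩
  · rw [le_div_iff₀ (by positivity)] at h3
    linarith
  · rw [div_lt_iff₀ (by positivity)] at h4
    rw [div_le_iff₀ (by positivity)]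
    nlinarith

/-- Hardness is symmetric up to a constant factor. -/
theorem symm (h : Hard X Y ε) (hε : 0 < ε) : Hard Y X (6 * ε) := by
  rcases le_or_gt ε (1 / 2) with h2 | h2
  · obtain ⟨D, hD, hDε, hD4⟩ := exists_depth hε h2
    refine mono (ε := 2 * ε + 1 / D) (of_depth_le hD (fun T hT hTD => ?_) (by positivity))
      (by linarith)
    have h3 := h.rev hT
    have h4 := mul_le_mul_of_nonneg_left (h.sum_cost_le hD hDε hTD) hε.le
    linarith
  · exact of_one_le _ _ (by linarith)

end Hard

/-! ### Product distributions -/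

/-- A block input whose `j`-th block is `F j (ω j)`. -/
def blocks {J Ω ι : Type} (F : J → Ω → ι → Bool) (ω : J → Ω) : J × ι → Bool :=
  fun p => F p.1 (ω p.1) p.2

/-- Replacing the distribution of a single block changes the expectation of the output by at most
`ε` times the expected number of queries to this block. -/
lemma Hard.sum_blocks_sub_le {J Ω ι : Type} [Fintype J] [DecidableEq J] [Fintype Ω]
    (F : J → Ω → ι → Bool) (j : J) (Y : Ω → ι → Bool) {ε : ℝ} (h : Hard (F j) Y ε)
    {T : QTree (J × ι)} (hT : T.Bdd) :
    ∑ ω, T.out (blocks F ω) - ∑ ω, T.out (blocks (Function.update F j Y) ω) ≤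
      ε * ∑ ω, T.cost (fun p => if p.1 = j then 1 else 0) (blocks F ω) := by
  let e := (Equiv.funSplitAt j Ω).symm
  simp only [← e.sum_comp, Fintype.sum_prod_type_right, ← Finset.sum_sub_distrib]
  rw [Finset.mul_sum]
  simp only [Finset.sum_sub_distrib]
  rw [← Finset.sum_sub_distrib]
  refine Finset.sum_le_sum fun y _ => ?_
  let r : J × ι → ι ⊕ Bool := fun p =>
    if hp : p.1 = j then .inl p.2 else .inr (F p.1 (y ⟨p.1, hp⟩) p.2)
  have hX : ∀ z, (fun p => Sum.elim (F j z) id (r p)) = blocks F (e (z, y)) := by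
    intro z
    ext ⟨j', i⟩
    by_cases hj : j' = j
    · subst hj
      simp [r, blocks, e]
    · simp [r, blocks, e, hj]
  have hY : ∀ z, (fun p => Sum.elim (Y z) id (r p)) =
      blocks (Function.update F j Y) (e (z, y)) := by
    intro z
    ext ⟨j', i⟩
    by_cases hj : j' = j
    · subst hj
      simp [r, blocks, e]
    · simp [r, blocks, e, hj]
  have hw : (fun p => Sum.elim (1 : ι → ℝ) 0 (r p)) = fun p => if p.1 = j then 1 else 0 := by
    ext ⟨j', i⟩
    by_cases hj : j' = j <;> simp [r, hj]
  simpa only [QTree.out_subst, QTree.cost_subst, hX, hY, hw] using h (T.subst r) (hT.subst r)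

/-- Hardness of telling `J` independent samples of `X` from the same with one random block
resampled from `Y`. -/
theorem Hard.oneBlock {J Ω ι : Type} [Fintype J] [DecidableEq J] [Nonempty J]
    [Fintype Ω] {X Y : Ω → ι → Bool} {ε : ℝ} (h : Hard X Y ε) :
    Hard (Ω := J × (J → Ω)) (fun p => blocks (fun _ => X) p.2)
      (fun p => blocks (Function.update (fun _ => X) p.1 Y) p.2) (ε / Fintype.card J) := by
  intro T hT
  have hJ : (Fintype.card J : ℝ) ≠ 0 := by exact_mod_cast Fintype.card_ne_zero
  simp only [Fintype.sum_prod_type, ← Finset.sum_sub_distrib]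
  simp only [Finset.sum_sub_distrib]
  rw [← Finset.sum_sub_distrib, Finset.sum_const, Finset.card_univ, nsmul_eq_mul, ← mul_assoc,
    div_mul_cancel₀ _ hJ]
  calc _ ≤ ∑ j : J, ε * ∑ ω, T.cost (fun p => if p.1 = j then 1 else 0)
            (blocks (fun _ => X) ω) :=
        Finset.sum_le_sum fun j _ => Hard.sum_blocks_sub_le (fun _ => X) j Y h hT
    _ = _ := by
        rw [← Finset.mul_sum, Finset.sum_comm]
        simp only [QTree.sum_cost, Finset.sum_ite_eq, Finset.mem_univ, if_true]
        rfl

/-- Extend an input by all-false additional bits. -/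
def blank {ι κ : Type} (x : ι → Bool) : ι ⊕ κ → Bool := Sum.elim x fun _ => false

namespace QTree

variable {ι κ : Type}

/-- Restrict a tree to inputs whose additional bits are all false. -/
def blanked (T : QTree (ι ⊕ κ)) : QTree ι := T.subst (Sum.elim .inl fun _ => .inr false)

lemma sumElim_blank (x : ι → Bool) :
    (fun i => Sum.elim x id ((Sum.elim Sum.inl fun _ => Sum.inr false : ι ⊕ κ → ι ⊕ Bool) i)) =
      blank x := by
  ext (i | k) <;> rfl

lemma out_blanked (T : QTree (ι ⊕ κ)) (x : ι → Bool) : T.blanked.out x = T.out (blank x) := by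
  rw [blanked, out_subst, sumElim_blank]

lemma cost_blanked_le (T : QTree (ι ⊕ κ)) (x : ι → Bool) :
    T.blanked.cost 1 x ≤ T.cost 1 (blank x) := by
  rw [blanked, cost_subst, sumElim_blank]
  refine cost_mono (fun i => ?_) _ _
  cases i <;> simp

end QTree

section Hybrids

variable {Ω ι M : Type} {c : ℕ}

/-- The block distributions prescribed by `l`, with the first `m` of them replaced
by `X false`. -/
def hybrid (X : Bool → Ω → ι → Bool) (l : Fin c → Bool) (m : ℕ) (i : Fin c) : Ω → ι → Bool :=
  X (if i.val < m then false else l i)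

lemma hybrid_succ (X : Bool → Ω → ι → Bool) (l : Fin c → Bool) {m : ℕ} (hm : m < c) :
    hybrid X l (m + 1) = Function.update (hybrid X l m) ⟨m, hm⟩ (X false) := by
  ext i ω v
  by_cases h : i = ⟨m, hm⟩
  · subst h
    simp [hybrid]
  · have : i.val ≠ m := fun h' => h (Fin.ext h')
    simp only [Function.update_of_ne h, hybrid, show i.val < m + 1 ↔ i.val < m by omega]

variable [Fintype Ω] {X : Bool → Ω → ι → Bool} {ε : ℝ}

lemma hybrid_step (h : Hard (X true) (X false) ε) (hε : 0 ≤ ε) (l : Fin c → Bool) {m : ℕ}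
    (hm : m < c) {T : QTree (Fin c × ι)} (hT : T.Bdd) :
    ∑ ω, T.out (blocks (hybrid X l m) ω) - ∑ ω, T.out (blocks (hybrid X l (m + 1)) ω) ≤
      ε * ∑ ω, T.cost 1 (blocks (hybrid X l m) ω) := by
  have h1 : Hard (hybrid X l m ⟨m, hm⟩) (X false) ε := by
    simp only [hybrid, lt_irrefl, if_false]
    cases l ⟨m, hm⟩
    exacts [Hard.refl _ hε, h]
  rw [hybrid_succ X l hm]
  refine (Hard.sum_blocks_sub_le _ _ _ h1 hT).trans (mul_le_mul_of_nonneg_left ?_ hε)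
  refine Finset.sum_le_sum fun ω _ => QTree.cost_mono (fun p => ?_) _ _
  simp only [Pi.one_apply]
  split_ifs <;> norm_num

lemma hybrid_step_rev (h : Hard (X true) (X false) ε) (hε : 0 ≤ ε) (l : Fin c → Bool) {m : ℕ}
    (hm : m < c) {T : QTree (Fin c × ι)} (hT : T.Bdd) :
    ∑ ω, T.out (blocks (hybrid X l (m + 1)) ω) - ∑ ω, T.out (blocks (hybrid X l m) ω) ≤
      ε * ∑ ω, T.cost 1 (blocks (hybrid X l m) ω) := by
  have := hybrid_step h hε l hm hT.compl
  simp only [QTree.out_compl, QTree.cost_compl, Finset.sum_sub_distrib] at this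
  linarith

/-- The expected number of queries is about the same in all hybrids. -/
lemma hybrid_cost_le (h : Hard (X true) (X false) ε) (hε : 0 ≤ ε) (l : Fin c → Bool)
    {κ : Type} {T : QTree (Fin c × ι ⊕ κ)} {D : ℕ} (hD : 0 < D) (hDε : c * ε * D ≤ 1 / 2)
    (hT : T.depth ≤ D) {m : ℕ} (hm : m ≤ c) :
    ∑ ω, T.cost 1 (blank (blocks (hybrid X l m) ω)) ≤
      2 * ∑ ω, T.cost 1 (blank (blocks (hybrid X l 0) ω)) := by
  have hD' : (0 : ℝ) < D := by exact_mod_cast hD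
  set q : ℕ → ℝ := fun m => ∑ ω, T.cost 1 (blank (blocks (hybrid X l m) ω)) with hq
  have hq0 : ∀ m, 0 ≤ q m := fun m => Hard.sum_cost_nonneg _ T
  have step : ∀ m < c, q (m + 1) ≤ (1 + ε * D) * q m := by
    intro m hm
    have h1 := hybrid_step_rev h hε l hm (T := (T.costTree D 0).blanked)
      ((QTree.bdd_costTree hD' le_rfl (by rw [zero_add]; exact_mod_cast hT)).subst _)
    simp only [QTree.out_blanked, QTree.out_costTree, zero_add, ← Finset.sum_div] at h1
    rw [← sub_div, div_le_iff₀ hD'] at h1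
    have h2 : ∑ ω, (T.costTree D 0).blanked.cost 1 (blocks (hybrid X l m) ω) ≤ q m :=
      Finset.sum_le_sum fun ω _ => (QTree.cost_blanked_le _ _).trans
        (QTree.cost_costTree _ _ _ _ _).le
    have h3 := mul_le_mul_of_nonneg_left h2 (mul_nonneg hε hD'.le)
    simp only [hq] at *
    linarith
  have key : ∀ m ≤ c, q m ≤ (1 + 2 * m * (ε * D)) * q 0 := by
    intro m
    induction m with
    | zero => simp
    | succ m ih =>
      intro hm
      have hm' : (m : ℝ) ≤ c := by exact_mod_cast (Nat.le_succ m).trans hm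
      have hδ : 0 ≤ ε * D := by positivity
      have h1 : 2 * m * (ε * D) ≤ 1 := by nlinarith [mul_le_mul_of_nonneg_right hm' hδ]
      calc q (m + 1) ≤ (1 + ε * D) * q m := step m hm
        _ ≤ (1 + ε * D) * ((1 + 2 * m * (ε * D)) * q 0) :=
            mul_le_mul_of_nonneg_left (ih (by omega)) (by positivity)
        _ = ((1 + ε * D) * (1 + 2 * m * (ε * D))) * q 0 := by ring
        _ ≤ _ := by
            refine mul_le_mul_of_nonneg_right ?_ (hq0 0)
            push_cast
            nlinarith [mul_le_mul_of_nonneg_right h1 hδ]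
  have hm' : (m : ℝ) ≤ c := by exact_mod_cast hm
  refine (key m hm).trans (mul_le_mul_of_nonneg_right ?_ (hq0 0))
  nlinarith [mul_le_mul_of_nonneg_right hm' (mul_nonneg hε hD'.le)]

/-- If the address bits are hard to compute, then an input with blank cells is hard to tell from
the input whose cell at the correct address is filled in. -/
theorem Hard.sheet (h : Hard (X true) (X false) ε) (hε : 0 < ε) (hc : 0 < c)
    (hcε : (1 / 2 : ℝ) ^ c ≤ ε) (E : (Fin c → Bool) → (Fin c → Ω) → M → Bool) :
    Hard (Ω := (Fin c → Bool) × (Fin c → Ω))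
      (fun p => blank (κ := (Fin c → Bool) × M) (blocks (fun i => X (p.1 i)) p.2))
      (fun p => Sum.elim (blocks (fun i => X (p.1 i)) p.2)
        fun q => if q.1 = p.1 then E p.1 p.2 q.2 else false) (8 * c * ε) := by
  have hc1 : (1 : ℝ) ≤ c := by exact_mod_cast hc
  rcases lt_or_ge (1 / 2) (c * ε) with h2 | h2
  · exact of_one_le _ _ (by linarith)
  obtain ⟨D, hD, hDε, hD4⟩ := exists_depth (by positivity) h2
  refine mono (ε := 4 * c * ε + 1 / D) (of_depth_le hD (fun T hT hTD => ?_) (by positivity))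
    (by linarith)
  set A : (Fin c → Bool) → Set (Fin c × ι ⊕ (Fin c → Bool) × M) :=
    fun l => {i | ∃ m, i = .inr (l, m)} with hA
  set q : (Fin c → Bool) → ℕ → ℝ :=
    fun l m => ∑ ω, T.cost 1 (blank (blocks (hybrid X l m) ω)) with hq
  set H : (Fin c → Bool) → ℕ → ℝ :=
    fun l m => ∑ ω, (T.hit (A l)).out (blank (blocks (hybrid X l m) ω)) with hH
  have hq2 : ∀ l, ∀ m ≤ c, q l m ≤ 2 * q l 0 := fun l m hm =>
    hybrid_cost_le h hε.le l hD hDε hTD hm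
  have step : ∀ l, ∀ m < c, H l m ≤ H l (m + 1) + 2 * ε * q l 0 := by
    intro l m hm
    have h1 := hybrid_step h hε.le l hm (T := (T.hit (A l)).blanked)
      ((QTree.bdd_hit _ _).subst _)
    simp only [QTree.out_blanked] at h1
    have h3 : ∑ ω, (T.hit (A l)).blanked.cost 1 (blocks (hybrid X l m) ω) ≤ q l m :=
      Finset.sum_le_sum fun ω _ => (QTree.cost_blanked_le _ _).trans
        (QTree.cost_hit_le _ (fun _ => zero_le_one) _ _)
    have h4 := mul_le_mul_of_nonneg_left (h3.trans (hq2 l m hm.le)) hε.le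
    simp only [hH] at *
    linarith
  have chain : ∀ l, ∀ m ≤ c, H l 0 ≤ H l m + m * (2 * ε * q l 0) := by
    intro l m
    induction m with
    | zero => simp
    | succ m ih =>
      intro hm
      have := ih (by omega)
      have := step l m hm
      push_cast
      linarith
  have last : ∑ l, H l c ≤ 2 * ε * ∑ l, q l 0 := by
    have hF : ∀ l, hybrid X l c = fun _ : Fin c => X false := fun l => by
      funext i
      simp [hybrid]
    have h1 : ∑ l, H l c ≤ ∑ ω, T.cost 1 (blank (blocks (fun _ => X false) ω)) := by
      simp only [hH, hF]
      rw [Finset.sum_comm]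
      refine Finset.sum_le_sum fun ω _ => ?_
      refine (Finset.sum_le_sum fun l _ => QTree.out_hit_le _ _ _).trans ?_
      rw [QTree.sum_cost]
      refine QTree.cost_mono (fun i => ?_) _ _
      rcases i with i | ⟨l', m⟩
      · simp [hA, Set.indicator]
      · simp [hA, Set.indicator]
    have h2 : ∑ l, q l c = 2 ^ c * ∑ ω, T.cost 1 (blank (blocks (fun _ => X false) ω)) := by
      simp only [hq, hF]
      simp
    have h3 : ∑ l, q l c ≤ 2 * ∑ l, q l 0 := by
      rw [Finset.mul_sum]
      exact Finset.sum_le_sum fun l _ => hq2 l c le_rfl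
    have h4 : ∑ l, H l c ≤ (1 / 2) ^ c * (2 * ∑ l, q l 0) := by
      refine h1.trans ?_
      rw [h2] at h3
      rw [one_div, inv_pow, inv_mul_eq_div, le_div_iff₀ (by positivity)]
      linarith
    have h5 : 0 ≤ ∑ l, q l 0 := Finset.sum_nonneg fun l _ => Hard.sum_cost_nonneg _ T
    nlinarith [mul_le_mul_of_nonneg_right hcε h5]
  have hF : ∀ l : Fin c → Bool, hybrid X l 0 = fun i => X (l i) := fun l => by
    funext i
    simp [hybrid]
  have first : ∑ p : (Fin c → Bool) × (Fin c → Ω),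
      (T.out (blank (blocks (fun i => X (p.1 i)) p.2)) -
        T.out (Sum.elim (blocks (fun i => X (p.1 i)) p.2)
          fun q => if q.1 = p.1 then E p.1 p.2 q.2 else false)) ≤ ∑ l, H l 0 := by
    rw [Fintype.sum_prod_type]
    refine Finset.sum_le_sum fun l _ => ?_
    simp only [hH, hF]
    refine Finset.sum_le_sum fun ω _ => hT.out_sub_out_le fun i hi => ?_
    rcases i with i | ⟨l', m⟩
    · rfl
    · have : l' ≠ l := by
        rintro rfl
        exact hi ⟨m, rfl⟩
      simp [blank, this]
  rw [← Finset.sum_sub_distrib]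
  refine first.trans ?_
  have h6 : ∑ l, H l 0 ≤ ∑ l, H l c + c * (2 * ε * ∑ l, q l 0) := by
    rw [Finset.mul_sum, Finset.mul_sum, ← Finset.sum_add_distrib]
    exact Finset.sum_le_sum fun l _ => chain l c le_rfl
  have h7 : ∑ p : (Fin c → Bool) × (Fin c → Ω),
      T.cost 1 (blank (blocks (fun i => X (p.1 i)) p.2)) = ∑ l, q l 0 := by
    rw [Fintype.sum_prod_type]
    simp only [hq, hF]
  have h5 : 0 ≤ ε * ∑ l, q l 0 :=
    mul_nonneg hε.le (Finset.sum_nonneg fun l _ => Hard.sum_cost_nonneg _ T)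
  rw [h7]
  nlinarith [mul_le_mul_of_nonneg_right hc1 h5]

end Hybrids

/-! ### Certificates, as sets of positions depending on the input -/

/-- Every input `x` with `f x = b` has a `b`-certificate on at most `w` positions. -/
def CertLe {ι : Type} (f : (ι → Bool) → Bool) (b : Bool) (w : ℕ) : Prop :=
  ∃ Q : (ι → Bool) → Finset ι, ∀ x, f x = b →
    (Q x).card ≤ w ∧ ∀ y, (∀ i ∈ Q x, y i = x i) → f y = b

/-- As `CertLe`, for an unambiguous family of certificates: all inputs consistent with the
certificate of `x` are assigned the same positions as `x`. -/
def UCertLe {ι : Type} (f : (ι → Bool) → Bool) (b : Bool) (w : ℕ) : Prop :=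
  ∃ Q : (ι → Bool) → Finset ι, ∀ x, f x = b →
    (Q x).card ≤ w ∧ ∀ y, (∀ i ∈ Q x, y i = x i) → f y = b ∧ Q y = Q x

section Certificates

variable {ι : Type} {f : (ι → Bool) → Bool} {b : Bool} {v w : ℕ}

lemma CertLe.mono (h : CertLe f b v) (hvw : v ≤ w) : CertLe f b w :=
  h.imp fun _ hQ x hx => ⟨(hQ x hx).1.trans hvw, (hQ x hx).2⟩

lemma UCertLe.mono (h : UCertLe f b v) (hvw : v ≤ w) : UCertLe f b w :=
  h.imp fun _ hQ x hx => ⟨(hQ x hx).1.trans hvw, (hQ x hx).2⟩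

lemma UCertLe.certLe (h : UCertLe f b w) : CertLe f b w :=
  h.imp fun _ hQ x hx => ⟨(hQ x hx).1, fun y hy => ((hQ x hx).2 y hy).1⟩

/-- Certificates for both values can be chosen by a single function. -/
lemma CertLe.both (h0 : CertLe f false w) (h1 : CertLe f true w) :
    ∃ Q : (ι → Bool) → Finset ι, ∀ x, (Q x).card ≤ w ∧
      ∀ y, (∀ i ∈ Q x, y i = x i) → f y = f x := by
  obtain ⟨Q0, h0⟩ := h0
  obtain ⟨Q1, h1⟩ := h1
  refine ⟨fun x => if f x then Q1 x else Q0 x, fun x => ?_⟩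
  cases hx : f x
  · simpa [hx] using h0 x hx
  · simpa [hx] using h1 x hx

lemma UCertLe.both (h0 : UCertLe f false v) (h1 : UCertLe f true w) :
    ∃ Q : (ι → Bool) → Finset ι, ∀ x, (Q x).card ≤ (if f x then w else v) ∧
      ∀ y, (∀ i ∈ Q x, y i = x i) → f y = f x ∧ Q y = Q x := by
  obtain ⟨Q0, h0⟩ := h0
  obtain ⟨Q1, h1⟩ := h1
  refine ⟨fun x => if f x then Q1 x else Q0 x, fun x => ?_⟩
  cases hx : f x
  · refine ⟨by simpa [hx] using (h0 x hx).1, fun y hy => ?_⟩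
    have := (h0 x hx).2 y (by simpa [hx] using hy)
    exact ⟨this.1, by simp [hx, this]⟩
  · refine ⟨by simpa [hx] using (h1 x hx).1, fun y hy => ?_⟩
    have := (h1 x hx).2 y (by simpa [hx] using hy)
    exact ⟨this.1, by simp [hx, this]⟩

end Certificates

/-! ### Negated conjunctions -/

/-- The negated conjunction of `g` over `n` disjoint blocks of variables. -/
def nand {ι : Type} (n : ℕ) (g : (ι → Bool) → Bool) (x : Fin n × ι → Bool) : Bool :=
  !decide (∀ j, g (fun i => x (j, i)) = true)

section Nand

variable {ι : Type} {g : (ι → Bool) → Bool} {n v w : ℕ} {x : Fin n × ι → Bool}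

lemma nand_eq_false : nand n g x = false ↔ ∀ j, g (fun i => x (j, i)) = true := by
  simp [nand]

lemma nand_eq_true : nand n g x = true ↔ ∃ j, g (fun i => x (j, i)) = false := by
  simp [nand]

lemma CertLe.nand_true (h : CertLe g false w) : CertLe (nand n g) true w := by
  classical
  obtain ⟨Q, hQ⟩ := h
  have hj : ∀ x : Fin n × ι → Bool, ∃ P : Finset (Fin n × ι), nand n g x = true →
      P.card ≤ w ∧ ∀ y, (∀ i ∈ P, y i = x i) → nand n g y = true := by
    intro x
    by_cases hx : nand n g x = true
    · obtain ⟨j, hj⟩ := nand_eq_true.1 hx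
      refine ⟨(Q fun i => x (j, i)).image (Prod.mk j), fun _ =>
        ⟨Finset.card_image_le.trans (hQ _ hj).1, fun y hy => nand_eq_true.2 ⟨j, ?_⟩⟩⟩
      exact (hQ _ hj).2 _ fun i hi => hy _ (Finset.mem_image_of_mem _ hi)
    · exact ⟨∅, fun h => absurd h hx⟩
  choose P hP using hj
  exact ⟨P, hP⟩

lemma CertLe.nand_false (h : CertLe g true w) : CertLe (nand n g) false (n * w) := by
  classical
  obtain ⟨Q, hQ⟩ := h
  refine ⟨fun x => Finset.univ.biUnion fun j => (Q fun i => x (j, i)).image (Prod.mk j),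
    fun x hx => ⟨?_, fun y hy => nand_eq_false.2 fun j => ?_⟩⟩
  · rw [nand_eq_false] at hx
    refine (Finset.card_biUnion_le_card_mul _ _ w fun j _ =>
      Finset.card_image_le.trans (hQ _ (hx j)).1).trans ?_
    simp
  · rw [nand_eq_false] at hx
    refine (hQ _ (hx j)).2 _ fun i hi => hy _ ?_
    exact Finset.mem_biUnion.2 ⟨j, Finset.mem_univ j, Finset.mem_image_of_mem _ hi⟩

lemma UCertLe.nand_false (h : UCertLe g true w) : UCertLe (nand n g) false (n * w) := by
  classical
  obtain ⟨Q, hQ⟩ := h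
  refine ⟨fun x => Finset.univ.biUnion fun j => (Q fun i => x (j, i)).image (Prod.mk j),
    fun x hx => ⟨?_, fun y hy => ?_⟩⟩
  · rw [nand_eq_false] at hx
    refine (Finset.card_biUnion_le_card_mul _ _ w fun j _ =>
      Finset.card_image_le.trans (hQ _ (hx j)).1).trans ?_
    simp
  · rw [nand_eq_false] at hx
    have key : ∀ j, g (fun i => y (j, i)) = true ∧
        Q (fun i => y (j, i)) = Q fun i => x (j, i) := fun j => by
      refine (hQ _ (hx j)).2 _ fun i hi => hy _ ?_
      exact Finset.mem_biUnion.2 ⟨j, Finset.mem_univ j, Finset.mem_image_of_mem _ hi⟩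
    exact ⟨nand_eq_false.2 fun j => (key j).1, by simp only [(key _).2]⟩

/-- Evaluate the blocks in order until one of them is false. -/
lemma UCertLe.nand_true (h0 : UCertLe g false v) (h1 : UCertLe g true w) :
    UCertLe (nand n g) true (n * w + v) := by
  classical
  obtain ⟨Q, hQ⟩ := h0.both h1
  set V : (Fin n × ι → Bool) → Finset (Fin n) := fun x =>
    Finset.univ.filter fun j => ∀ j' < j, g (fun i => x (j', i)) = true with hV
  refine ⟨fun x => (V x).biUnion fun j => (Q fun i => x (j, i)).image (Prod.mk j),
    fun x hx => ⟨?_, fun y hy => ?_⟩⟩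
  · obtain ⟨j0, hj0⟩ := nand_eq_true.1 hx
    calc _ ≤ ∑ j ∈ V x, ((Q fun i => x (j, i)).image (Prod.mk j)).card :=
          Finset.card_biUnion_le
      _ ≤ ∑ j ∈ V x, (w + if g (fun i => x (j, i)) = false then v else 0) := by
          refine Finset.sum_le_sum fun j _ => Finset.card_image_le.trans ((hQ _).1.trans ?_)
          cases g (fun i => x (j, i)) <;> simp
      _ = (V x).card * w + ((V x).filter fun j => g (fun i => x (j, i)) = false).card * v := by
          rw [Finset.sum_add_distrib, ← Finset.sum_filter]
          simp
      _ ≤ n * w + 1 * v := by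
          refine Nat.add_le_add (Nat.mul_le_mul_right _ ?_) (Nat.mul_le_mul_right _ ?_)
          · simpa using Finset.card_le_univ (V x)
          · refine Finset.card_le_one.2 fun a ha b hb => ?_
            simp only [hV, Finset.mem_filter, Finset.mem_univ, true_and] at ha hb
            rcases lt_trichotomy a b with h | h | h
            · simp [hb.1 a h] at ha
            · exact h
            · simp [ha.1 b h] at hb
      _ = _ := by rw [one_mul]
  · have key : ∀ j ∈ V x, g (fun i => y (j, i)) = g (fun i => x (j, i)) ∧
        Q (fun i => y (j, i)) = Q fun i => x (j, i) := fun j hj => by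
      refine (hQ _).2 _ fun i hi => hy _ ?_
      exact Finset.mem_biUnion.2 ⟨j, hj, Finset.mem_image_of_mem _ hi⟩
    have hVV : V y = V x := by
      ext j
      simp only [hV, Finset.mem_filter, Finset.mem_univ, true_and]
      constructor
      · intro h j'
        induction j' using WellFoundedLT.induction with
        | _ j' ih =>
          intro hj'
          rw [← (key j' (Finset.mem_filter.2 ⟨Finset.mem_univ _, fun a ha =>
            ih a ha (ha.trans hj')⟩)).1]
          exact h j' hj'
      · intro h j' hj'
        rw [(key j' (Finset.mem_filter.2 ⟨Finset.mem_univ _, fun a ha =>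
          h a (ha.trans hj')⟩)).1]
        exact h j' hj'
    obtain ⟨j, hj, hmin⟩ : ∃ j, g (fun i => x (j, i)) = false ∧
        ∀ j' < j, g (fun i => x (j', i)) = true := by
      have hne : (Finset.univ.filter fun j => g (fun i => x (j, i)) = false).Nonempty := by
        obtain ⟨j, hj⟩ := nand_eq_true.1 hx
        exact ⟨j, by simpa using hj⟩
      have h1 := Finset.min'_mem _ hne
      refine ⟨_, by simpa using h1, fun j' hj' => ?_⟩
      by_contra h
      exact absurd (Finset.min'_le _ j' (by simpa using h)) (not_le.2 hj')
    refine ⟨nand_eq_true.2 ⟨j, ?_⟩, ?_⟩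
    · rw [(key j (Finset.mem_filter.2 ⟨Finset.mem_univ _, hmin⟩)).1, hj]
    · simp only [hVV]
      exact Finset.biUnion_congr rfl fun j hj => by rw [(key j hj).2]

end Nand

/-! ### Cheat sheets -/

section CheatSheet

variable {ι : Type} {c W b : ℕ}

/-- The positions of one cell of the cheat sheet: a flag, and for each of the `c` copies the names
of `W` variables, written with `b` bits each. -/
abbrev Cell (c W b : ℕ) : Type := Option (Fin c × Fin W × Fin b)

/-- The positions of an input of the cheat sheet function. -/
abbrev SheetIdx (ι : Type) (c W b : ℕ) : Type :=
  Fin c × ι ⊕ (Fin c → Bool) × Cell c W b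

/-- The address of the relevant cell: the values of `h` on the `c` copies. -/
def addr (h : (ι → Bool) → Bool) (x : SheetIdx ι c W b → Bool) (i : Fin c) : Bool :=
  h fun v => x (.inl (i, v))

/-- The variables named in the cell with address `l`. -/
def named (dec : (Fin b → Bool) → ι) (x : SheetIdx ι c W b → Bool) (l : Fin c → Bool)
    (p : Fin c × Fin W) : ι :=
  dec fun t => x (.inr (l, some (p.1, p.2, t)))

open Classical in
/-- The cheat sheet version of `h`: the flag of the relevant cell is set and the variables named
in this cell certify the values of `h` on all copies. -/
noncomputable def sheet (h : (ι → Bool) → Bool) (dec : (Fin b → Bool) → ι)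
    (x : SheetIdx ι c W b → Bool) : Bool :=
  decide (x (.inr (addr h x, none)) = true ∧ ∀ i, ∀ z : ι → Bool,
    (∀ w : Fin W, z (named dec x (addr h x) (i, w)) = x (.inl (i, named dec x (addr h x) (i, w)))) →
      h z = addr h x i)

variable {h : (ι → Bool) → Bool} {dec : (Fin b → Bool) → ι}

lemma sheet_eq_true {x : SheetIdx ι c W b → Bool} : sheet h dec x = true ↔
    x (.inr (addr h x, none)) = true ∧ ∀ i, ∀ z : ι → Bool,
      (∀ w : Fin W, z (named dec x (addr h x) (i, w)) =
        x (.inl (i, named dec x (addr h x) (i, w)))) → h z = addr h x i := by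
  simp [sheet]

open Classical in
/-- The relevant cell together with the variables named in it. -/
noncomputable def readSet (h : (ι → Bool) → Bool) (dec : (Fin b → Bool) → ι)
    (x : SheetIdx ι c W b → Bool) : Finset (SheetIdx ι c W b) :=
  (Finset.univ.image fun m : Cell c W b => Sum.inr (addr h x, m)) ∪
    Finset.univ.image fun p : Fin c × Fin W => Sum.inl (p.1, named dec x (addr h x) p)

lemma card_readSet_le (x : SheetIdx ι c W b → Bool) :
    (readSet h dec x).card ≤ c * W * b + 1 + c * W := by
  classical
  refine (Finset.card_union_le _ _).trans (Nat.add_le_add ?_ ?_)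
  · refine Finset.card_image_le.trans (le_of_eq ?_)
    simp [Fintype.card_option, mul_assoc]
  · refine Finset.card_image_le.trans (le_of_eq ?_)
    simp

section Agree

variable {x y : SheetIdx ι c W b → Bool}

lemma agree_cell (hy : ∀ i ∈ readSet h dec x, y i = x i) (m : Cell c W b) :
    y (.inr (addr h x, m)) = x (.inr (addr h x, m)) := by
  classical
  refine hy _ (Finset.mem_union_left _ ?_)
  simp

lemma agree_named (hy : ∀ i ∈ readSet h dec x, y i = x i) :
    named dec y (addr h x) = named dec x (addr h x) := by
  funext p
  simp only [named, agree_cell hy]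

lemma agree_var (hy : ∀ i ∈ readSet h dec x, y i = x i) (p : Fin c × Fin W) :
    y (.inl (p.1, named dec x (addr h x) p)) = x (.inl (p.1, named dec x (addr h x) p)) := by
  classical
  refine hy _ (Finset.mem_union_right _ ?_)
  exact Finset.mem_image.2 ⟨p, Finset.mem_univ _, rfl⟩

lemma sheet_congr (hy : ∀ i ∈ readSet h dec x, y i = x i)
    (ha : addr h y = addr h x) :
    sheet h dec y = sheet h dec x ∧ readSet h dec y = readSet h dec x := by
  constructor
  · rw [Bool.eq_iff_iff, sheet_eq_true, sheet_eq_true, ha, agree_named hy, agree_cell hy]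
    simp only [fun i w => agree_var hy (i, w)]
  · simp only [readSet, ha, agree_named hy]

lemma addr_congr (hy : ∀ i ∈ readSet h dec x, y i = x i)
    (hx : sheet h dec x = true) : addr h y = addr h x := by
  funext i
  exact (sheet_eq_true.1 hx).2 i _ fun w => agree_var hy (i, w)

end Agree

lemma sheet_uCertLe_true :
    UCertLe (sheet (c := c) (W := W) h dec) true (c * W * b + 1 + c * W) :=
  ⟨readSet h dec, fun x hx => ⟨card_readSet_le x, fun _ hy =>
    (sheet_congr hy (addr_congr hy hx)).imp_left fun h => h.trans hx⟩⟩

lemma sheet_certLe_false {u : ℕ} (h0 : CertLe h false u) (h1 : CertLe h true u) :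
    CertLe (sheet (c := c) (W := W) h dec) false (c * u + (c * W * b + 1 + c * W)) := by
  classical
  obtain ⟨Q, hQ⟩ := h0.both h1
  refine ⟨fun x => (Finset.univ.biUnion fun i => (Q fun v => x (.inl (i, v))).image
    fun v => Sum.inl (i, v)) ∪ readSet h dec x, fun x hx => ⟨?_, fun y hy => ?_⟩⟩
  · refine (Finset.card_union_le _ _).trans (Nat.add_le_add ?_ (card_readSet_le x))
    refine (Finset.card_biUnion_le_card_mul _ _ u fun j _ =>
      Finset.card_image_le.trans (hQ _).1).trans ?_
    simp
  · have ha : addr h y = addr h x := by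
      funext i
      refine (hQ _).2 _ fun v hv => hy _ (Finset.mem_union_left _ ?_)
      exact Finset.mem_biUnion.2 ⟨i, Finset.mem_univ _, Finset.mem_image_of_mem _ hv⟩
    rw [← hx]
    exact (sheet_congr (fun i hi => hy i (Finset.mem_union_right _ hi)) ha).1

lemma sheet_uCertLe_false {u : ℕ} (h0 : UCertLe h false u) (h1 : UCertLe h true u) :
    UCertLe (sheet (c := c) (W := W) h dec) false (c * u + (c * W * b + 1 + c * W)) := by
  classical
  obtain ⟨Q, hQ⟩ := h0.both h1
  refine ⟨fun x => (Finset.univ.biUnion fun i => (Q fun v => x (.inl (i, v))).image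
    fun v => Sum.inl (i, v)) ∪ readSet h dec x, fun x hx => ⟨?_, fun y hy => ?_⟩⟩
  · refine (Finset.card_union_le _ _).trans (Nat.add_le_add ?_ (card_readSet_le x))
    refine (Finset.card_biUnion_le_card_mul _ _ u fun j _ =>
      Finset.card_image_le.trans ((hQ _).1.trans (by simp))).trans ?_
    simp
  · have ha : ∀ i, addr h y i = addr h x i ∧
        Q (fun v => y (.inl (i, v))) = Q fun v => x (.inl (i, v)) := by
      intro i
      refine (hQ _).2 _ fun v hv => hy _ (Finset.mem_union_left _ ?_)
      exact Finset.mem_biUnion.2 ⟨i, Finset.mem_univ _, Finset.mem_image_of_mem _ hv⟩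
    have hs := sheet_congr (fun i hi => hy i (Finset.mem_union_right _ hi))
      (funext fun i => (ha i).1)
    rw [← hx]
    exact ⟨hs.1, by simp only [hs.2, (ha _).2]⟩

lemma addr_sumElim (x : Fin c × ι → Bool) (y : (Fin c → Bool) × Cell c W b → Bool) :
    addr h (Sum.elim x y) = fun i => h fun v => x (i, v) := rfl

lemma exists_enumeration [Nonempty ι] {s : Finset ι} (hs : s.card ≤ W) :
    ∃ e : Fin W → ι, ∀ v ∈ s, ∃ w, e w = v := by
  rcases s.eq_empty_or_nonempty with rfl | hne
  · exact ⟨fun _ => Classical.arbitrary ι, by simp⟩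
  · have : Nonempty s := hne.to_subtype
    obtain ⟨φ⟩ := Function.Embedding.nonempty_of_card_le (α := s) (β := Fin W) (by simpa using hs)
    refine ⟨fun w => (Function.invFun φ w : s), fun v hv => ?_⟩
    obtain ⟨w, hw⟩ := Function.invFun_surjective φ.injective ⟨v, hv⟩
    exact ⟨w, congrArg Subtype.val hw⟩

/-- The relevant cell can be filled so that the cheat sheet function becomes true. -/
lemma exists_fill [Nonempty ι] (hdec : dec.Surjective) (h0 : CertLe h false W)
    (h1 : CertLe h true W) (x : Fin c × ι → Bool) : ∃ E : Cell c W b → Bool,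
    sheet h dec (Sum.elim x fun q : (Fin c → Bool) × Cell c W b =>
      if q.1 = (fun i => h fun v => x (i, v)) then E q.2 else false) = true := by
  obtain ⟨Q, hQ⟩ := h0.both h1
  choose e he using fun i => exists_enumeration (hQ fun v => x (i, v)).1
  choose enc henc using hdec
  refine ⟨fun m => m.elim true fun p => enc (e p.1 p.2.1) p.2.2, sheet_eq_true.2 ⟨?_, ?_⟩⟩
  · simp [addr_sumElim]
  · intro i z hz
    refine (hQ _).2 z fun v hv => ?_
    obtain ⟨w, rfl⟩ := he i v hv
    simpa [named, addr_sumElim, henc] using hz w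

lemma sheet_blank (x : Fin c × ι → Bool) :
    sheet (c := c) (W := W) h dec (blank x) = false := by
  rw [← Bool.not_eq_true, sheet_eq_true]
  simp [blank]

end CheatSheet

/-! ### Functions with a hard pair of input distributions -/

/-- Some distribution on `f⁻¹(b)` is `ε`-hard to tell from some distribution on `f⁻¹(!b)`. -/
def HardFor {ι : Type} (f : (ι → Bool) → Bool) (b : Bool) (ε : ℝ) : Prop :=
  ∃ (Ω : Type) (_ : Fintype Ω) (_ : Nonempty Ω) (X : Bool → Ω → ι → Bool),
    (∀ c ω, f (X c ω) = c) ∧ Hard (X b) (X !b) ε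

namespace HardFor

variable {ι : Type} {f : (ι → Bool) → Bool} {b : Bool} {ε δ : ℝ}

lemma mono (h : HardFor f b ε) (hε : ε ≤ δ) : HardFor f b δ := by
  obtain ⟨Ω, _, _, X, hX, hh⟩ := h
  exact ⟨Ω, _, ‹_›, X, hX, hh.mono hε⟩

lemma symm (h : HardFor f b ε) (hε : 0 < ε) : HardFor f (!b) (6 * ε) := by
  obtain ⟨Ω, _, _, X, hX, hh⟩ := h
  exact ⟨Ω, _, ‹_›, X, hX, by simpa using hh.symm hε⟩

lemma nonempty (h : HardFor f b ε) : Nonempty ι := by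
  obtain ⟨Ω, _, ⟨ω⟩, X, hX, -⟩ := h
  by_contra hι
  rw [not_nonempty_iff] at hι
  have h1 := hX true ω
  rw [Subsingleton.elim (X true ω) (X false ω), hX false ω] at h1
  simp at h1

lemma nand {n : ℕ} (hn : 0 < n) (h : HardFor f true ε) :
    HardFor (_root_.nand n f) false (ε / n) := by
  obtain ⟨Ω, _, _, X, hX, hh⟩ := h
  have : NeZero n := ⟨hn.ne'⟩
  refine ⟨Fin n × (Fin n → Ω), inferInstance, inferInstance, fun c p =>
    if c then blocks (Function.update (fun _ => X true) p.1 (X false)) p.2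
    else blocks (fun _ => X true) p.2, ?_, ?_⟩
  · rintro (_ | _) ⟨j, ω⟩
    · exact nand_eq_false.2 fun j => hX true (ω j)
    · refine nand_eq_true.2 ⟨j, ?_⟩
      simpa [blocks] using hX false (ω j)
  · simpa using hh.oneBlock (J := Fin n)

lemma sheet {c W m : ℕ} (hc : 0 < c) (hε : 0 < ε) (hcε : (1 / 2 : ℝ) ^ c ≤ ε)
    {dec : (Fin m → Bool) → ι} (hdec : dec.Surjective) (h0 : CertLe f false W)
    (h1 : CertLe f true W) (h : HardFor f true ε) :
    HardFor (_root_.sheet (c := c) (W := W) f dec) false (8 * c * ε) := by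
  have := h.nonempty
  obtain ⟨Ω, _, _, X, hX, hh⟩ := h
  choose E hE using fun p : (Fin c → Bool) × (Fin c → Ω) =>
    exists_fill (W := W) hdec h0 h1 (blocks (fun i => X (p.1 i)) p.2)
  refine ⟨(Fin c → Bool) × (Fin c → Ω), inferInstance, inferInstance, fun b p =>
    if b then Sum.elim (blocks (fun i => X (p.1 i)) p.2)
      fun q => if q.1 = p.1 then E p q.2 else false
    else blank (blocks (fun i => X (p.1 i)) p.2), ?_, ?_⟩
  · rintro (_ | _) p
    · exact sheet_blank _
    · have := hE p
      simpa [blocks, hX] using this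
  · simpa using hh.sheet hε hc hcε fun l ω => E (l, ω)

end HardFor

/-- There is a function on at most `N` variables, with unambiguous certificates of size `u` and
`1`-certificates of size `v`, which is `ε`-hard. -/
def Separated (N u v : ℕ) (ε : ℝ) : Prop :=
  ∃ (ι : Type) (_ : Fintype ι) (f : (ι → Bool) → Bool), Fintype.card ι ≤ N ∧
    UCertLe f false u ∧ UCertLe f true u ∧ CertLe f true v ∧ HardFor f true ε

namespace Separated

lemma mono {N N' u u' v v' : ℕ} {ε ε' : ℝ} (h : Separated N u v ε) (hN : N ≤ N') (hu : u ≤ u')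
    (hv : v ≤ v') (hε : ε ≤ ε') : Separated N' u' v' ε' := by
  obtain ⟨ι, _, f, h1, h2, h3, h4, h5⟩ := h
  exact ⟨ι, _, f, h1.trans hN, h2.mono hu, h3.mono hu, h4.mono hv, h5.mono hε⟩

/-- The negated conjunction of `n` variables. -/
lemma base {n : ℕ} (hn : 0 < n) : Separated n (n + 1) 1 (6 / n) := by
  have hn' : (0 : ℝ) < n := by exact_mod_cast hn
  have hU : ∀ b, UCertLe (fun x : Unit → Bool => x ()) b 1 := fun b =>
    ⟨fun _ => {()}, fun x hx => ⟨by simp, fun y hy => ⟨(hy () (by simp)).trans hx, rfl⟩⟩⟩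
  have hH : HardFor (fun x : Unit → Bool => x ()) true 1 :=
    ⟨Unit, inferInstance, inferInstance, fun c _ _ => c, fun _ _ => rfl, Hard.of_one_le _ _ le_rfl⟩
  refine ⟨Fin n × Unit, inferInstance, nand n fun x => x (), by simp,
    (hU true).nand_false.mono (by omega), ?_, (hU false).certLe.nand_true, ?_⟩
  · simpa using (hU false).nand_true (n := n) (hU true)
  · exact ((hH.nand hn).symm (by positivity)).mono (le_of_eq (by ring))

/-- One round: negated conjunction, cheat sheet, negated conjunction. -/
lemma step {n c b W N u v : ℕ} {ε : ℝ} (h : Separated N u v ε) (hn : 0 < n) (hc : 0 < c)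
    (hε : 0 < ε) (hcε : (1 / 2 : ℝ) ^ c ≤ 6 * (ε / n)) (hb : n * N ≤ 2 ^ b) (hu : u ≤ W)
    (hv : n * v ≤ W) :
    Separated (n * (c * (n * N) + 2 ^ c * (c * W * b + 1)))
      (n * (c * W * b + 1 + c * W) + (c * (n * u + u) + (c * W * b + 1 + c * W)))
      (c * W + (c * W * b + 1 + c * W)) (1728 * c * ε / n ^ 2) := by
  classical
  obtain ⟨ι, _, f, hN, hU0, hU1, hC1, hH⟩ := h
  have hn' : (0 : ℝ) < n := by exact_mod_cast hn
  have hc' : (0 : ℝ) < c := by exact_mod_cast hc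
  have hh : HardFor (nand n f) true (6 * (ε / n)) := (hH.nand hn).symm (by positivity)
  have := hh.nonempty
  obtain ⟨dec, hdec⟩ : ∃ dec : (Fin b → Bool) → Fin n × ι, dec.Surjective := by
    obtain ⟨φ⟩ := Function.Embedding.nonempty_of_card_le (α := Fin n × ι) (β := Fin b → Bool)
      (by simpa using (Nat.mul_le_mul_left n hN).trans hb)
    exact ⟨Function.invFun φ, Function.invFun_surjective φ.injective⟩
  have hC0' : CertLe (nand n f) false W := hC1.nand_false.mono hv
  have hC1' : CertLe (nand n f) true W := hU0.certLe.nand_true.mono hu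
  have hU0' : UCertLe (nand n f) false (n * u + u) := hU1.nand_false.mono (by omega)
  have hU1' : UCertLe (nand n f) true (n * u + u) := hU0.nand_true hU1
  have hg := hh.sheet (W := W) hc (by positivity) hcε hdec hC0' hC1'
  refine ⟨Fin n × SheetIdx (Fin n × ι) c W b, inferInstance, nand n (_root_.sheet (nand n f) dec),
    ?_, sheet_uCertLe_true.nand_false.mono (by omega),
    (sheet_uCertLe_false hU0' hU1').nand_true sheet_uCertLe_true,
    (sheet_certLe_false hC0' hC1').nand_true, ?_⟩
  · simp only [Fintype.card_prod, Fintype.card_sum, Fintype.card_fin, Fintype.card_option,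
      Fintype.card_pi, Fintype.card_bool, Finset.prod_const, Finset.card_univ, ← mul_assoc]
    simp only [mul_assoc]
    gcongr
  · refine (((hg.symm (by positivity)).nand hn).symm (by positivity)).mono (le_of_eq ?_)
    field_simp
    ring

end Separated

/-! ### Growth of the parameters -/

lemma pow_clog_le {n : ℕ} (hn : 2 ≤ n) : 2 ^ Nat.clog 2 n ≤ 2 * n := by
  have h1 := Nat.pow_pred_clog_lt_self one_lt_two hn
  have h2 : 0 < Nat.clog 2 n := Nat.clog_pos one_lt_two hn
  obtain ⟨m, hm⟩ := Nat.exists_eq_succ_of_ne_zero h2.ne'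
  rw [hm, Nat.pred_succ] at h1
  rw [hm, Nat.succ_eq_add_one, pow_succ]
  omega

lemma clog_pow_le {n : ℕ} (hn : 2 ≤ n) {e : ℕ} (he : 0 < e) :
    Nat.clog 2 n ^ e ≤ 2 * e ^ e * n := by
  set L := Nat.clog 2 n with hL
  have h1 : L ≤ e * 2 ^ (L / e) := by
    have h2 : L / e + 1 ≤ 2 ^ (L / e) := Nat.lt_two_pow_self
    have h3 := Nat.mul_le_mul_left e h2
    have h4 := Nat.lt_mul_div_succ L he
    omega
  calc L ^ e ≤ (e * 2 ^ (L / e)) ^ e := Nat.pow_le_pow_left h1 e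
    _ = e ^ e * 2 ^ (L / e * e) := by rw [mul_pow, ← pow_mul]
    _ ≤ e ^ e * 2 ^ L := by gcongr; exacts [by norm_num, Nat.div_mul_le_self L e]
    _ ≤ e ^ e * (2 * n) := Nat.mul_le_mul_left _ (pow_clog_le hn)
    _ = _ := by ring

lemma clog_le_logb {n : ℕ} (hn : 2 ≤ n) : (Nat.clog 2 n : ℝ) ≤ 2 * Real.logb 2 n := by
  have hn' : (2 : ℝ) ≤ n := by exact_mod_cast hn
  have h1 : (1 : ℝ) ≤ Real.logb 2 n := by
    rw [Real.le_logb_iff_rpow_le one_lt_two (by linarith)]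
    simpa using hn'
  have h2 : (Nat.clog 2 n : ℝ) ≤ Real.logb 2 (2 * n) := by
    rw [Real.le_logb_iff_rpow_le one_lt_two (by linarith), Real.rpow_natCast]
    exact_mod_cast pow_clog_le hn
  rw [Real.logb_mul two_ne_zero (by linarith), Real.logb_self_eq_one one_lt_two] at h2
  linarith

theorem exists_separated (k : ℕ) : ∃ a d : ℕ, 0 < a ∧ 0 < d ∧ ∀ n, 2 ≤ n →
    Separated (a * n ^ 25 ^ k) (a * n ^ (k + 1) * Nat.clog 2 n ^ d) (a * n ^ k * Nat.clog 2 n ^ d)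
      (a * Nat.clog 2 n ^ d / n ^ (2 * k + 1)) := by
  induction k with
  | zero =>
    refine ⟨6, 1, by norm_num, one_pos, fun n hn => ?_⟩
    have hL : 0 < Nat.clog 2 n := Nat.clog_pos one_lt_two hn
    have hL' : (1 : ℝ) ≤ Nat.clog 2 n := by exact_mod_cast hL
    refine (Separated.base (by omega : 0 < n)).mono ?_ ?_ ?_ ?_
    · simp only [pow_zero, pow_one]
      omega
    · simp only [zero_add, pow_one]
      nlinarith
    · simp only [pow_zero, pow_one]
      omega
    · simp only [pow_one, mul_zero, zero_add]
      gcongr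
      push_cast
      linarith
  | succ k ih =>
    obtain ⟨a, d, ha, hd, ih⟩ := ih
    set c₀ := 2 * k + 2 with hc₀
    set b₀ := a + 25 ^ k + 1 with hb₀
    set K := 2 * a * c₀ * b₀ + 1 + 2 * a * c₀ with hK
    set B := 2 * (d + 2) ^ (d + 2) with hB
    set a' := (c₀ * a + 4 ^ (k + 1) * K * B) + 2 * (K + c₀ * a) + (2 * a * c₀ + K) +
      1728 * c₀ * a with ha'
    refine ⟨a', d + 2, by positivity, by omega, fun n hn => ?_⟩
    set L := Nat.clog 2 n with hL
    replace ih := ih n hn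
    rw [← hL] at ih
    have hL1 : 1 ≤ L := Nat.clog_pos one_lt_two hn
    have hn0 : 0 < n := by omega
    have hnL : n ≤ 2 ^ L := Nat.le_pow_clog one_lt_two n
    have hLn : 2 ^ L ≤ 2 * n := pow_clog_le hn
    have hLn' : L ≤ n := Nat.clog_le_of_le_pow Nat.lt_two_pow_self.le
    have hLB : L ^ (d + 2) ≤ B * n := clog_pow_le hn (by omega)
    have hLd : 1 ≤ L ^ d := Nat.one_le_pow _ _ hL1
    set c := c₀ * L with hc
    set b := b₀ * L with hb
    set W := 2 * (a * n ^ (k + 1) * L ^ d) with hW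
    have hm : c * W * b + 1 + c * W ≤ K * n ^ (k + 1) * L ^ (d + 2) := by
      have h1 : 1 ≤ n ^ (k + 1) * L ^ (d + 2) :=
        Nat.one_le_iff_ne_zero.2 (by positivity)
      have h2 : L ^ (d + 1) ≤ L ^ (d + 2) := Nat.pow_le_pow_right hL1 (by omega)
      have h3 : c * W * b = 2 * a * c₀ * b₀ * (n ^ (k + 1) * L ^ (d + 2)) := by
        simp only [hc, hW, hb]; ring
      have h4 : c * W ≤ 2 * a * c₀ * (n ^ (k + 1) * L ^ (d + 2)) := by
        calc c * W = 2 * a * c₀ * (n ^ (k + 1) * L ^ (d + 1)) := by simp only [hc, hW]; ring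
          _ ≤ _ := by gcongr
      calc _ ≤ 2 * a * c₀ * b₀ * (n ^ (k + 1) * L ^ (d + 2)) + n ^ (k + 1) * L ^ (d + 2) +
            2 * a * c₀ * (n ^ (k + 1) * L ^ (d + 2)) := by rw [h3]; gcongr
        _ = _ := by simp only [hK]; ring
    have hcW : c * W ≤ 2 * a * c₀ * n ^ (k + 1) * L ^ (d + 2) := by
      have h2 : L ^ (d + 1) ≤ L ^ (d + 2) := Nat.pow_le_pow_right hL1 (by omega)
      calc c * W = 2 * a * c₀ * n ^ (k + 1) * L ^ (d + 1) := by simp only [hc, hW]; ring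
        _ ≤ _ := by gcongr
    have hnR : (0 : ℝ) < n := by exact_mod_cast hn0
    have haR : (1 : ℝ) ≤ a := by exact_mod_cast ha
    have hLR : (1 : ℝ) ≤ L := by exact_mod_cast hL1
    have hLdR : (1 : ℝ) ≤ (L : ℝ) ^ d := one_le_pow₀ hLR
    refine (Separated.step ih (c := c) (b := b) (W := W) hn0 (by positivity) (by positivity)
      ?_ ?_ ?_ ?_).mono ?_ ?_ ?_ ?_
    · have h1 : ((n : ℝ)) ^ c₀ ≤ 2 ^ c := by
        have : n ^ c₀ ≤ 2 ^ c := by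
          calc n ^ c₀ ≤ (2 ^ L) ^ c₀ := Nat.pow_le_pow_left hnL _
            _ = 2 ^ c := by rw [← pow_mul, mul_comm L]
        exact_mod_cast this
      calc (1 / 2 : ℝ) ^ c = 1 / 2 ^ c := by rw [div_pow, one_pow]
        _ ≤ 1 / (n : ℝ) ^ c₀ := one_div_le_one_div_of_le (by positivity) h1
        _ ≤ 6 * (a * L ^ d) / (n : ℝ) ^ c₀ := by
            gcongr
            nlinarith
        _ = _ := by
            rw [hc₀, show 2 * k + 2 = 2 * k + 1 + 1 by ring, pow_succ]
            field_simp
    · calc n * (a * n ^ 25 ^ k) = a * n ^ (25 ^ k + 1) := by ring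
        _ ≤ 2 ^ a * (2 ^ L) ^ (25 ^ k + 1) := by
            gcongr
            exact Nat.lt_two_pow_self.le
        _ = 2 ^ (a + L * (25 ^ k + 1)) := by rw [← pow_mul, ← pow_add]
        _ ≤ 2 ^ b := by
            refine Nat.pow_le_pow_right two_pos ?_
            simp only [hb, hb₀]
            nlinarith
    · omega
    · refine le_of_eq_of_le ?_ (show a * n ^ (k + 1) * L ^ d ≤ W by omega)
      ring
    · have h25 : k + 1 ≤ 25 ^ k := Nat.lt_pow_self (by norm_num)
      have e1 : 25 ^ k + 3 ≤ 25 ^ (k + 1) := by rw [pow_succ]; omega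
      have e2 : 3 * k + 5 ≤ 25 ^ (k + 1) := by rw [pow_succ]; omega
      have h2c : 2 ^ c ≤ 4 ^ (k + 1) * n ^ c₀ := by
        calc 2 ^ c = (2 ^ L) ^ c₀ := by rw [← pow_mul, mul_comm L]
          _ ≤ (2 * n) ^ c₀ := Nat.pow_le_pow_left hLn _
          _ = _ := by
            rw [mul_pow, hc₀, show 2 * k + 2 = 2 * (k + 1) by ring, pow_mul 2]
            norm_num
      have hm' : c * W * b + 1 ≤ K * n ^ (k + 1) * (B * n) :=
        (Nat.le_add_right _ _).trans (hm.trans (Nat.mul_le_mul_left _ hLB))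
      calc _ ≤ n * (c₀ * n * (n * (a * n ^ 25 ^ k)) +
              4 ^ (k + 1) * n ^ c₀ * (K * n ^ (k + 1) * (B * n))) := by
            gcongr
            exact Nat.mul_le_mul_left _ hLn'
        _ = c₀ * a * n ^ (25 ^ k + 3) + 4 ^ (k + 1) * K * B * n ^ (3 * k + 5) := by
            simp only [hc₀]; ring
        _ ≤ c₀ * a * n ^ 25 ^ (k + 1) + 4 ^ (k + 1) * K * B * n ^ 25 ^ (k + 1) := by
            gcongr
        _ = (c₀ * a + 4 ^ (k + 1) * K * B) * n ^ 25 ^ (k + 1) := by ring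
        _ ≤ _ := by
            gcongr
            simp only [ha']
            omega
    · have h1 : c * (a * n ^ (k + 1) * L ^ d) ≤ c₀ * a * n ^ (k + 1) * L ^ (d + 2) := by
        have h2 : L ^ (d + 1) ≤ L ^ (d + 2) := Nat.pow_le_pow_right hL1 (by omega)
        calc _ = c₀ * a * n ^ (k + 1) * L ^ (d + 1) := by simp only [hc]; ring
          _ ≤ _ := by gcongr
      calc _ = (n + 1) * (c * W * b + 1 + c * W) + (n + 1) * (c * (a * n ^ (k + 1) * L ^ d)) := by
            ring
        _ ≤ (2 * n) * (K * n ^ (k + 1) * L ^ (d + 2)) +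
              (2 * n) * (c₀ * a * n ^ (k + 1) * L ^ (d + 2)) := by
            gcongr <;> omega
        _ = (2 * (K + c₀ * a)) * n ^ (k + 1 + 1) * L ^ (d + 2) := by ring
        _ ≤ _ := by
            gcongr
            simp only [ha']
            omega
    · calc _ ≤ 2 * a * c₀ * n ^ (k + 1) * L ^ (d + 2) + K * n ^ (k + 1) * L ^ (d + 2) :=
            Nat.add_le_add hcW hm
        _ = (2 * a * c₀ + K) * n ^ (k + 1) * L ^ (d + 2) := by ring
        _ ≤ _ := by
            gcongr
            simp only [ha']
            omega
    · have h1 : (1728 * c₀ * a : ℝ) ≤ a' := by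
        have : 1728 * c₀ * a ≤ a' := Nat.le_add_left _ _
        exact_mod_cast this
      have h2 : (L : ℝ) ^ (d + 1) ≤ (L : ℝ) ^ (d + 2) := pow_le_pow_right₀ hLR (by omega)
      calc _ = 1728 * c₀ * a * (L : ℝ) ^ (d + 1) / (n : ℝ) ^ (2 * (k + 1) + 1) := by
            rw [hc, show 2 * (k + 1) + 1 = 2 * k + 1 + 2 by ring, pow_add (n : ℝ) (2 * k + 1)]
            push_cast
            field_simp
            ring
        _ ≤ _ := by gcongr

/-! ### From hardness and certificates to query complexity and subcube partitions -/

section Reindex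

variable {ι κ : Type} {f : (ι → Bool) → Bool} {b : Bool}

lemma UCertLe.reindex {w : ℕ} (h : UCertLe f b w) (e : ι ≃ κ) :
    UCertLe (fun x : κ → Bool => f (x ∘ e)) b w := by
  obtain ⟨Q, hQ⟩ := h
  refine ⟨fun x => (Q (x ∘ e)).map e.toEmbedding, fun x hx => ⟨?_, fun y hy => ?_⟩⟩
  · simpa using (hQ _ hx).1
  · have := (hQ _ hx).2 (y ∘ e) fun i hi =>
      hy (e i) (Finset.mem_map.2 ⟨i, hi, rfl⟩)
    exact ⟨this.1, congrArg (Finset.map e.toEmbedding) this.2⟩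

lemma HardFor.reindex {ε : ℝ} (h : HardFor f b ε) (e : ι ≃ κ) :
    HardFor (fun x : κ → Bool => f (x ∘ e)) b ε := by
  obtain ⟨Ω, hΩ, hne, X, hX, hh⟩ := h
  refine ⟨Ω, hΩ, hne, fun c ω => X c ω ∘ e.symm, fun c ω => ?_, fun T hT => ?_⟩
  · simp only [Function.comp_assoc, Equiv.symm_comp_self, Function.comp_id, hX]
  · have := hh (T.subst fun i => .inl (e.symm i)) (hT.subst _)
    simp only [QTree.out_subst, QTree.cost_subst] at this
    exact this

end Reindex

lemma UCertLe.uCb_le {n w : ℕ} {f : (Fin n → Bool) → Bool} {b : Bool} (h : UCertLe f b w) :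
    UCb f b ≤ w := by
  obtain ⟨Q, hQ⟩ := h
  set P : (Fin n → Bool) → Fin n → Option Bool :=
    fun x i => if i ∈ Q x then some (x i) else none with hP
  have hcons : ∀ x y, Consistent y (P x) ↔ ∀ i ∈ Q x, y i = x i := by
    intro x y
    simp only [Consistent, hP]
    constructor
    · intro h i hi
      exact h i _ (if_pos hi)
    · intro h i c hc
      split_ifs at hc with hi
      rw [h i hi]
      exact Option.some_injective _ hc
  refine Nat.sInf_le ⟨P '' {x | f x = b}, ?_, fun x hx => ?_⟩
  · rintro _ ⟨x, hx, rfl⟩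
    refine ⟨fun y hy => ((hQ x hx).2 y ((hcons x y).1 hy)).1, ?_⟩
    refine le_trans (Finset.card_le_card fun i hi => ?_) (hQ x hx).1
    by_contra h
    simp [hP, h] at hi
  · refine ⟨P x, ⟨⟨x, hx, rfl⟩, (hcons x x).2 fun _ _ => rfl⟩, ?_⟩
    rintro _ ⟨⟨y, hy, rfl⟩, hxy⟩
    rw [hcons] at hxy
    have := ((hQ y hy).2 x hxy).2
    funext i
    simp only [hP, this]
    split_ifs with hi
    · rw [hxy i hi]
    · rfl

/-- Every Boolean function is computed by some decision tree. -/
lemma DT.exists_eval_eq {n : ℕ} (f : (Fin n → Bool) → Bool) :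
    ∃ T : DT n, ∀ x, T.eval x = f x := by
  suffices H : ∀ (s : Finset (Fin n)) (f : (Fin n → Bool) → Bool),
      (∀ x y, (∀ i ∈ s, x i = y i) → f x = f y) → ∃ T : DT n, ∀ x, T.eval x = f x from
    H Finset.univ f fun x y h => by rw [funext fun i => h i (Finset.mem_univ i)]
  intro s
  induction s using Finset.induction_on with
  | empty => exact fun f hf => ⟨.leaf (f fun _ => false), fun x => hf _ _ (by simp)⟩
  | insert i s _ ih =>
    intro f hf
    have h : ∀ c, ∃ T : DT n, ∀ x, T.eval x = f (Function.update x i c) := fun c => by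
      refine ih (fun x => f (Function.update x i c)) fun x y hxy => hf _ _ fun j hj => ?_
      by_cases hji : j = i
      · subst hji
        simp
      · simpa [hji] using hxy j (Finset.mem_of_mem_insert_of_ne hj hji)
    obtain ⟨T0, h0⟩ := h false
    obtain ⟨T1, h1⟩ := h true
    refine ⟨.node i T0 T1, fun x => ?_⟩
    simp only [DT.eval, h0, h1]
    split_ifs with hx
    · rw [← hx, Function.update_eq_self]
    · rw [← Bool.eq_false_of_not_eq_true hx, Function.update_eq_self]

/-- The indicator of the event that a decision tree outputs `b`. -/
def DT.toQTree {n : ℕ} (b : Bool) : DT n → QTree (Fin n)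
  | .leaf c => .leaf (if c = b then 1 else 0)
  | .node i t0 t1 => .node i (t0.toQTree b) (t1.toQTree b)

section ToQTree

variable {n : ℕ} (b : Bool) (T : DT n)

lemma DT.out_toQTree (x : Fin n → Bool) :
    (T.toQTree b).out x = if T.eval x = b then 1 else 0 := by
  induction T with
  | leaf c => rfl
  | node i t0 t1 h0 h1 => simp only [toQTree, QTree.out, eval, h0, h1]; split_ifs <;> rfl

lemma DT.bdd_toQTree : (T.toQTree b).Bdd := by
  induction T with
  | leaf c => simp only [toQTree, QTree.Bdd]; split_ifs <;> simp
  | node i t0 t1 h0 h1 => exact ⟨h0, h1⟩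

lemma DT.depth_toQTree : (T.toQTree b).depth = T.depth := by
  induction T with
  | leaf c => rfl
  | node i t0 t1 h0 h1 => simp only [toQTree, QTree.depth, depth, h0, h1, add_comm]

end ToQTree

section Randomized

variable {n : ℕ}

/-- The total weight of the trees which output `b` on `x`. -/
def outputWeight (ts : List (DT n × ℝ)) (b : Bool) (x : Fin n → Bool) : ℝ :=
  ((ts.filter fun p => p.1.eval x == b).map Prod.snd).sum

lemma outputWeight_cons (p : DT n × ℝ) (ts : List (DT n × ℝ)) (b : Bool) (x : Fin n → Bool) :
    outputWeight (p :: ts) b x = (p.1.toQTree b).out x * p.2 + outputWeight ts b x := by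
  simp only [outputWeight, List.filter_cons, DT.out_toQTree, beq_iff_eq]
  split_ifs <;> simp

lemma outputWeight_add_not (ts : List (DT n × ℝ)) (b : Bool) (x : Fin n → Bool) :
    outputWeight ts b x + outputWeight ts (!b) x = (ts.map Prod.snd).sum := by
  induction ts with
  | nil => simp [outputWeight]
  | cons p ts ih =>
    rw [outputWeight_cons, outputWeight_cons, List.map_cons, List.sum_cons, ← ih,
      DT.out_toQTree, DT.out_toQTree]
    cases p.1.eval x <;> cases b <;> simp <;> ring

lemma Hard.sum_outputWeight_sub_le {Ω : Type} [Fintype Ω] {X Y : Ω → Fin n → Bool} {ε : ℝ}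
    (h : Hard X Y ε) (hε : 0 ≤ ε) (b : Bool) {d : ℕ} {ts : List (DT n × ℝ)}
    (hts : ∀ p ∈ ts, 0 ≤ p.2 ∧ p.1.depth ≤ d) :
    ∑ ω, outputWeight ts b (X ω) - ∑ ω, outputWeight ts b (Y ω) ≤
      ε * (d * Fintype.card Ω) * (ts.map Prod.snd).sum := by
  induction ts with
  | nil => simp [outputWeight]
  | cons p ts ih =>
    have h1 := ih fun q hq => hts q (List.mem_cons_of_mem _ hq)
    obtain ⟨hp, hpd⟩ := hts p List.mem_cons_self
    have h2 := h (p.1.toQTree b) (p.1.bdd_toQTree b)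
    have h3 : ∑ ω, (p.1.toQTree b).cost 1 (X ω) ≤ d * Fintype.card Ω := by
      have h4 : ∀ ω ∈ Finset.univ, (p.1.toQTree b).cost 1 (X ω) ≤ (d : ℝ) := fun ω _ => by
        refine (QTree.cost_le_depth _ _).trans ?_
        rw [DT.depth_toQTree]
        exact_mod_cast hpd
      have := Finset.sum_le_card_nsmul _ _ _ h4
      rw [nsmul_eq_mul, Finset.card_univ] at this
      linarith
    have h5 := mul_le_mul_of_nonneg_right (h2.trans (mul_le_mul_of_nonneg_left h3 hε)) hp
    simp only [outputWeight_cons, Finset.sum_add_distrib, ← Finset.sum_mul, List.map_cons,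
      List.sum_cons]
    linarith

lemma HardFor.le_mul_rquery {f : (Fin n → Bool) → Bool} {b : Bool} {ε : ℝ} (h : HardFor f b ε)
    (hε : 0 ≤ ε) : 1 / 3 ≤ ε * Rquery f := by
  obtain ⟨Ω, _, _, X, hX, hh⟩ := h
  have hmem := Nat.sInf_mem (s := {d : ℕ | ∃ ts : List (DT n × ℝ),
    (∀ p ∈ ts, 0 ≤ p.2 ∧ p.1.depth ≤ d) ∧ (ts.map Prod.snd).sum = 1 ∧
    ∀ x : Fin n → Bool,
      (2 : ℝ) / 3 ≤ ((ts.filter (fun p => p.1.eval x == f x)).map Prod.snd).sum}) (by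
    obtain ⟨T, hT⟩ := DT.exists_eval_eq f
    refine ⟨T.depth, [(T, 1)], by simp, by simp, fun x => ?_⟩
    simp only [hT, beq_self_eq_true, List.filter_cons_of_pos, List.filter_nil, List.map_cons,
      List.map_nil, List.sum_singleton]
    norm_num)
  obtain ⟨ts, hts, hsum, hsucc⟩ := hmem
  change ∀ p ∈ ts, 0 ≤ p.2 ∧ p.1.depth ≤ Rquery f at hts
  have h1 := hh.sum_outputWeight_sub_le hε b hts
  rw [← Finset.sum_sub_distrib, hsum, mul_one] at h1
  have h2 : ∀ ω ∈ Finset.univ, (1 / 3 : ℝ) ≤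
      outputWeight ts b (X b ω) - outputWeight ts b (X (!b) ω) := fun ω _ => by
    have h3 : 2 / 3 ≤ outputWeight ts b (X b ω) := by
      have := hsucc (X b ω)
      rwa [hX b ω] at this
    have h4 : 2 / 3 ≤ outputWeight ts (!b) (X (!b) ω) := by
      have := hsucc (X (!b) ω)
      rwa [hX (!b) ω] at this
    have h5 := outputWeight_add_not ts b (X (!b) ω)
    linarith
  have h3 := (Finset.card_nsmul_le_sum _ _ _ h2).trans h1
  rw [nsmul_eq_mul, Finset.card_univ] at h3
  have h4 : (0 : ℝ) < Fintype.card Ω := by exact_mod_cast Fintype.card_pos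
  exact le_of_mul_le_mul_left (by linarith) h4

end Randomized

lemma Separated.exists_fin {N u v : ℕ} {ε : ℝ} (h : Separated N u v ε) (hε : 0 ≤ ε) :
    ∃ (N' : ℕ) (f : (Fin N' → Bool) → Bool), N' ≤ N ∧ 1 / 3 ≤ ε * Rquery f ∧ UC f ≤ u := by
  obtain ⟨ι, _, f, hN, h0, h1, -, hH⟩ := h
  let e := Fintype.equivFin ι
  exact ⟨_, fun x => f (x ∘ e), hN, (hH.reindex e).le_mul_rquery hε,
    max_le (h0.reindex e).uCb_le (h1.reindex e).uCb_le⟩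

theorem stmt3 (k : ℕ) :
    ∃ (a : ℝ) (d : ℕ), 0 < a ∧ 0 < d ∧ ∀ n : ℕ, 2 ≤ n →
      ∃ (N : ℕ) (f : (Fin N → Bool) → Bool),
        (N : ℝ) ≤ a * (n : ℝ) ^ (25 ^ k) ∧
        (n : ℝ) ^ (2 * k + 1) / (a * Real.logb 2 n ^ d) ≤ (Rquery f : ℝ) ∧
        (UC f : ℝ) ≤ a * (n : ℝ) ^ (k + 1) * Real.logb 2 n ^ d := by
  obtain ⟨a, d, ha, hd, h⟩ := exists_separated k
  have haR : (0 : ℝ) < a := by exact_mod_cast ha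
  refine ⟨3 * a * 2 ^ d, d, by positivity, hd, fun n hn => ?_⟩
  obtain ⟨N, f, hN, hR, hU⟩ := (h n hn).exists_fin (by positivity)
  have hnR : (0 : ℝ) < n := by exact_mod_cast (by omega : 0 < n)
  have hL : (0 : ℝ) < Nat.clog 2 n := by exact_mod_cast Nat.clog_pos one_lt_two hn
  have hlog := clog_le_logb hn
  have hpow : (Nat.clog 2 n : ℝ) ^ d ≤ 2 ^ d * Real.logb 2 n ^ d := by
    rw [← mul_pow]
    exact pow_le_pow_left₀ hL.le hlog d
  have hlog0 : 0 < Real.logb 2 n := by linarith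
  have h2d : (1 : ℝ) ≤ 2 ^ d := one_le_pow₀ one_le_two
  refine ⟨N, f, ?_, ?_, ?_⟩
  · have h1 : (N : ℝ) ≤ a * (n : ℝ) ^ 25 ^ k := by exact_mod_cast hN
    refine h1.trans ?_
    gcongr
    nlinarith
  · rw [div_le_iff₀ (by positivity)]
    rw [div_mul_eq_mul_div, le_div_iff₀ (by positivity)] at hR
    calc (n : ℝ) ^ (2 * k + 1) ≤ 3 * (a * (Nat.clog 2 n : ℝ) ^ d * Rquery f) := by linarith
      _ ≤ 3 * (a * (2 ^ d * Real.logb 2 n ^ d) * Rquery f) := by gcongr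
      _ = _ := by ring
  · have h1 : (UC f : ℝ) ≤ a * (n : ℝ) ^ (k + 1) * (Nat.clog 2 n : ℝ) ^ d := by exact_mod_cast hU
    calc (UC f : ℝ) ≤ a * (n : ℝ) ^ (k + 1) * (2 ^ d * Real.logb 2 n ^ d) := by
          refine h1.trans ?_
          gcongr
      _ = 1 * (a * 2 ^ d * (n : ℝ) ^ (k + 1) * Real.logb 2 n ^ d) := by ring
      _ ≤ 3 * (a * 2 ^ d * (n : ℝ) ^ (k + 1) * Real.logb 2 n ^ d) := by gcongr; norm_num
      _ = _ := by ring
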